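/- Let (W, Ω) be a real symplectic vector space of dimension 2n (Ω a nondegenerate alternating bilinear form on W), let V ⊂ W be a hyperplane, and let w ∈ W with w ∉ V. Set θ := (ι_w Ω)|_V (the restriction to V of the functional Ω(w, ·)) and η := Ω|_V. Then (θ, η) is a linear cosymplectic pair on V, i.e. θ ∧ η^(n−1) is a nonzero alternating (2n−1)-form on V. (This is the pointwise content of the fact that a hypersurface transverse to a symplectic vector field inherits a cosymplectic structure.) -/

import Mathlib

open scoped TensorProduct

/-- The wedge product of two real-valued alternating forms. -/
noncomputable def wedge {V : Type*} [AddCommGroup V] [Module ℝ V] {a b : ℕ}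
    (f : V [⋀^Fin a]→ₗ[ℝ] ℝ) (g : V [⋀^Fin b]→ₗ[ℝ] ℝ) :
    V [⋀^Fin (a + b)]→ₗ[ℝ] ℝ :=
  ((TensorProduct.lid ℝ ℝ).toLinearMap.compAlternatingMap
    (f.domCoprod g)).domDomCongr finSumFinEquiv

/-- The `k`-th wedge power of an alternating 2-form. -/
noncomputable def wpow {V : Type*} [AddCommGroup V] [Module ℝ V]
    (η : V [⋀^Fin 2]→ₗ[ℝ] ℝ) : (k : ℕ) → V [⋀^Fin (2 * k)]→ₗ[ℝ] ℝ
  | 0 => AlternatingMap.constOfIsEmpty ℝ V (Fin 0) 1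
  | k + 1 => wedge (wpow η k) η

/-- A linear functional `θ`, viewed as an alternating 1-form. -/
noncomputable def oneForm {V : Type*} [AddCommGroup V] [Module ℝ V]
    (θ : V →ₗ[ℝ] ℝ) : V [⋀^Fin 1]→ₗ[ℝ] ℝ :=
  AlternatingMap.ofSubsingleton ℝ V ℝ 0 θ

/-- `(θ, η)` is a linear cosymplectic pair on a `(2n-1)`-dimensional space:
`θ ∧ η^(n-1)` is a nonzero alternating `(2n-1)`-form. -/
def IsCosymplecticPair {V : Type*} [AddCommGroup V] [Module ℝ V] (n : ℕ)
    (θ : V →ₗ[ℝ] ℝ) (η : V [⋀^Fin 2]→ₗ[ℝ] ℝ) : Prop :=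
  wedge (oneForm θ) (wpow η (n - 1)) ≠ 0

/-- The flat ("index lowering") map `η♭ : V → V*`, `v ↦ η(v, ·)`,
of an alternating 2-form `η`. -/
noncomputable def flat {V : Type*} [AddCommGroup V] [Module ℝ V]
    (η : V [⋀^Fin 2]→ₗ[ℝ] ℝ) : V →ₗ[ℝ] (V →ₗ[ℝ] ℝ) :=
  LinearMap.mk₂ ℝ (fun v w => η ![v, w])
    (fun v v' w => η.map_vecCons_add ![w] v v')
    (fun c v w => η.map_vecCons_smul ![w] c v)
    (fun v w w' => (η.curryLeft v).map_vecCons_add ![] w w')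
    (fun c v w => (η.curryLeft v).map_vecCons_smul ![] c w)

open Equiv

section Wedge

variable {V : Type*} [AddCommGroup V] [Module ℝ V]

/-- The product of two real-valued multilinear forms, on concatenated arguments. -/
noncomputable def mulForm {a b : ℕ} (f : MultilinearMap ℝ (fun _ : Fin a => V) ℝ)
    (g : MultilinearMap ℝ (fun _ : Fin b => V) ℝ) :
    MultilinearMap ℝ (fun _ : Fin (a + b) => V) ℝ :=
  ((TensorProduct.lid ℝ ℝ).toLinearMap.compMultilinearMap
    (f.domCoprod g)).domDomCongr finSumFinEquiv

theorem mulForm_apply {a b : ℕ} (f : MultilinearMap ℝ (fun _ : Fin a => V) ℝ)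
    (g : MultilinearMap ℝ (fun _ : Fin b => V) ℝ) (v : Fin (a + b) → V) :
    mulForm f g v = f (fun i => v (Fin.castAdd b i)) * g (fun i => v (Fin.natAdd a i)) := by
  simp [mulForm]

theorem domDomCongr_alternatization {ι κ : Type*} [Fintype ι] [DecidableEq ι] [Fintype κ]
    [DecidableEq κ] (e : ι ≃ κ) (f : MultilinearMap ℝ (fun _ : ι => V) ℝ) :
    (f.domDomCongr e).alternatization = f.alternatization.domDomCongr e := by
  ext v
  simp only [AlternatingMap.domDomCongr_apply, MultilinearMap.alternatization_apply,
    MultilinearMap.domDomCongr_apply]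
  refine (Fintype.sum_equiv e.permCongr _ _ fun σ => ?_).symm
  simp

theorem wedge_alternatization {a b : ℕ} (f : MultilinearMap ℝ (fun _ : Fin a => V) ℝ)
    (g : MultilinearMap ℝ (fun _ : Fin b => V) ℝ) :
    wedge f.alternatization g.alternatization = (mulForm f g).alternatization := by
  rw [wedge, mulForm, domDomCongr_alternatization,
    LinearMap.compMultilinearMap_alternatization, MultilinearMap.domCoprod_alternization]

theorem wedge_smul_smul {a b : ℕ} (c d : ℝ) (f : V [⋀^Fin a]→ₗ[ℝ] ℝ)
    (g : V [⋀^Fin b]→ₗ[ℝ] ℝ) : wedge (c • f) (d • g) = (c * d) • wedge f g := by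
  have h : (c • f).domCoprod (d • g) = (c * d) • f.domCoprod g := by
    simp only [← AlternatingMap.domCoprod'_apply, ← TensorProduct.smul_tmul',
      TensorProduct.tmul_smul, map_smul, smul_smul, mul_comm]
  ext v
  simp [wedge, h]

/-- Splitting `2 * k` positions into `k` consecutive pairs. -/
def pairIndex (k : ℕ) : Fin k × Fin 2 ≃ Fin (2 * k) :=
  finProdFinEquiv.trans (finCongr (mul_comm k 2))

theorem pairIndex_val (k : ℕ) (x : Fin k × Fin 2) : (pairIndex k x : ℕ) = x.2 + 2 * x.1 := rfl

theorem exists_wpow_eq_alternatization (η : V [⋀^Fin 2]→ₗ[ℝ] ℝ) (k : ℕ) :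
    ∃ M : MultilinearMap ℝ (fun _ : Fin (2 * k) => V) ℝ,
      M.alternatization = (2 : ℝ) ^ k • wpow η k ∧
      ∀ v, M v = ∏ i, η ![v (pairIndex k (i, 0)), v (pairIndex k (i, 1))] := by
  induction k with
  | zero =>
    have : IsEmpty (Fin (2 * 0)) := inferInstanceAs (IsEmpty (Fin 0))
    refine ⟨MultilinearMap.constOfIsEmpty ℝ _ 1, ?_, by simp⟩
    ext v
    rw [MultilinearMap.alternatization_apply]
    rw [Fintype.sum_subsingleton _ 1]
    simp [wpow]
  | succ k ih =>
    obtain ⟨M, hM, hMv⟩ := ih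
    refine ⟨mulForm M (η : MultilinearMap ℝ (fun _ : Fin 2 => V) ℝ), ?_, fun v => ?_⟩
    · rw [← wedge_alternatization, hM, AlternatingMap.coe_alternatization,
        ← Nat.cast_smul_eq_nsmul ℝ, wedge_smul_smul, wpow]
      simp [pow_succ]
    · refine (mulForm_apply (a := 2 * k) M _ v).trans ?_
      rw [hMv, Fin.prod_univ_castSucc]
      congr 1
      · rw [AlternatingMap.coe_multilinearMap]
        refine congrArg η ?_
        ext i
        fin_cases i <;> simp <;> congr 1 <;> ext <;> simp [pairIndex_val, add_comm]

/-- Splitting `1 + 2 * k` positions into the first one and `k` consecutive pairs. -/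
def onePairIndex (k : ℕ) : Fin 1 ⊕ Fin k × Fin 2 ≃ Fin (1 + 2 * k) :=
  ((Equiv.refl _).sumCongr (pairIndex k)).trans finSumFinEquiv

theorem wedge_oneForm_wpow_apply (θ : V →ₗ[ℝ] ℝ) (η : V [⋀^Fin 2]→ₗ[ℝ] ℝ) (k : ℕ)
    (v : Fin 1 ⊕ Fin k × Fin 2 → V) :
    (2 : ℝ) ^ k * wedge (oneForm θ) (wpow η k) (v ∘ (onePairIndex k).symm) =
      ∑ σ : Perm (Fin 1 ⊕ Fin k × Fin 2), ((Perm.sign σ : ℤ) : ℝ) *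
        (θ (v (σ (Sum.inl 0))) *
          ∏ i, η ![v (σ (Sum.inr (i, 0))), v (σ (Sum.inr (i, 1)))]) := by
  obtain ⟨M, hM, hMv⟩ := exists_wpow_eq_alternatization η k
  have h1 : (oneForm θ : MultilinearMap ℝ (fun _ : Fin 1 => V) ℝ).alternatization
      = (1 : ℝ) • oneForm θ := by
    simp [AlternatingMap.coe_alternatization]
  have h := wedge_alternatization (oneForm θ : MultilinearMap ℝ (fun _ : Fin 1 => V) ℝ) M
  rw [hM, h1, wedge_smul_smul, one_mul] at h
  have hv := congrArg (fun f => f (v ∘ (onePairIndex k).symm)) h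
  simp only [AlternatingMap.smul_apply, smul_eq_mul] at hv
  rw [hv, MultilinearMap.alternatization_apply]
  refine (Fintype.sum_equiv (onePairIndex k).permCongr _ _ fun σ => ?_).symm
  have hinl : ∀ i, (onePairIndex k).symm (Fin.castAdd (2 * k) i) = Sum.inl i := fun i => by
    simp [onePairIndex]
  have hinr : ∀ x, (onePairIndex k).symm (Fin.natAdd 1 (pairIndex k x)) = Sum.inr x := fun x => by
    simp [onePairIndex]
  simp [MultilinearMap.domDomCongr_apply, mulForm_apply, hMv, hinl, hinr, oneForm,
    Units.smul_def, AlternatingMap.ofSubsingleton]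

end Wedge

section Sign

theorem sign_eq_sub_of_perm_fin_two (b : Perm (Fin 2)) :
    ((Perm.sign b : ℤ) : ℝ) = ((b 1 : ℕ) : ℝ) - ((b 0 : ℕ) : ℝ) := by
  have h : ∀ b : Perm (Fin 2), (Perm.sign b : ℤ) = ((b 1 : ℕ) : ℤ) - ((b 0 : ℕ) : ℤ) := by decide
  rw [h b]
  push_cast
  rfl

/-- The matrix of the standard symplectic form, with respect to `k` pairs of vectors. -/
def darboux {ι : Type*} [DecidableEq ι] (x y : ι × Fin 2) : ℝ :=
  if x.1 = y.1 then ((y.2 : ℕ) : ℝ) - ((x.2 : ℕ) : ℝ) else 0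

theorem sign_mul_prod_darboux_nonneg {ι : Type*} [DecidableEq ι] [Fintype ι]
    (σ : Perm (ι × Fin 2)) :
    0 ≤ ((Perm.sign σ : ℤ) : ℝ) * ∏ i, darboux (σ (i, 0)) (σ (i, 1)) := by
  by_cases h : ∀ i, (σ (i, 0)).1 = (σ (i, 1)).1
  swap
  · push Not at h
    obtain ⟨i, hi⟩ := h
    rw [Finset.prod_eq_zero (Finset.mem_univ i) (by simp [darboux, hi]), mul_zero]
  have h' : ∀ i a, (σ (i, a)).1 = (σ (i, 0)).1 := fun i a => by
    fin_cases a
    · rfl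
    · exact (h i).symm
  have hτ : Function.Bijective fun i => (σ (i, 0)).1 := by
    rw [← Finite.surjective_iff_bijective]
    intro j
    refine ⟨(σ.symm (j, 0)).1, ?_⟩
    simp only
    rw [← h' _ (σ.symm (j, 0)).2]
    simp
  have hb : ∀ i, Function.Bijective fun a => (σ (i, a)).2 := fun i => by
    rw [← Finite.injective_iff_bijective]
    intro a c hac
    have : σ (i, a) = σ (i, c) := Prod.ext ((h' i a).trans (h' i c).symm) hac
    simpa using this
  have hσ : σ = Equiv.prodCongrLeft (fun _ => Equiv.ofBijective _ hτ) *
      Equiv.prodCongrRight fun i => Equiv.ofBijective _ (hb i) := by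
    ext x : 1
    exact Prod.ext (h' x.1 x.2) rfl
  have hs : Perm.sign σ = ∏ i, Perm.sign (Equiv.ofBijective _ (hb i)) := by
    conv_lhs => rw [hσ]
    rw [Perm.sign_mul, Perm.sign_prodCongrLeft, Perm.sign_prodCongrRight]
    simp
  rw [hs]
  push_cast
  rw [← Finset.prod_mul_distrib]
  refine Finset.prod_nonneg fun i _ => ?_
  rw [sign_eq_sub_of_perm_fin_two]
  simp [darboux, h i, mul_self_nonneg]

end Sign

section Darboux

variable {V : Type*} [AddCommGroup V] [Module ℝ V]

theorem wedge_oneForm_wpow_ne_zero {θ : V →ₗ[ℝ] ℝ} {η : V [⋀^Fin 2]→ₗ[ℝ] ℝ} {k : ℕ}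
    (r : V) (v : Fin k × Fin 2 → V) (hr : θ r ≠ 0) (hθ : ∀ x, θ (v x) = 0)
    (hη : ∀ x y, η ![v x, v y] = darboux x y) :
    wedge (oneForm θ) (wpow η k) ≠ 0 := by
  intro h0
  have h := wedge_oneForm_wpow_apply θ η k (Sum.elim (fun _ => (θ r)⁻¹ • r) v)
  rw [h0, AlternatingMap.zero_apply, mul_zero] at h
  refine (Finset.sum_pos' (fun σ _ => ?_) ⟨1, Finset.mem_univ _, ?_⟩).ne h
  · by_cases hσ : ∃ x, σ (Sum.inl 0) = Sum.inr x
    · obtain ⟨x, hx⟩ := hσ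
      simp [hx, hθ]
    have hmap : Set.MapsTo σ (Set.range Sum.inl) (Set.range Sum.inl) := by
      rintro _ ⟨i, rfl⟩
      rw [Subsingleton.elim i 0]
      rcases hx : σ (Sum.inl 0) with j | x
      · exact ⟨j, rfl⟩
      · exact (hσ ⟨x, hx⟩).elim
    obtain ⟨⟨ρ, τ⟩, rfl⟩ := Perm.mem_sumCongrHom_range_of_perm_mapsTo_inl hmap
    have hρ : ρ = 1 := Subsingleton.elim _ _
    simpa [hρ, hη, hr] using sign_mul_prod_darboux_nonneg τ
  · simp [hη, hr, darboux]

end Darboux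

section Symplectic

variable {W : Type*} [AddCommGroup W] [Module ℝ W]

theorem flat_apply (Ω : W [⋀^Fin 2]→ₗ[ℝ] ℝ) (x y : W) : flat Ω x y = Ω ![x, y] := rfl

theorem flat_self (Ω : W [⋀^Fin 2]→ₗ[ℝ] ℝ) (x : W) : flat Ω x x = 0 :=
  Ω.map_eq_zero_of_eq ![x, x] (i := 0) (j := 1) rfl (by decide)

theorem flat_neg (Ω : W [⋀^Fin 2]→ₗ[ℝ] ℝ) (x y : W) : - flat Ω x y = flat Ω y x :=
  LinearMap.IsAlt.neg (B := flat Ω) (flat_self Ω) x y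

/-- In a subspace on which `Ω` is nondegenerate, the orthogonal complement of a pair of vectors
with `Ω u w ≠ 0` is again nondegenerate, and has codimension two. -/
theorem exists_orthogonal_pair [FiniteDimensional ℝ W] (Ω : W [⋀^Fin 2]→ₗ[ℝ] ℝ)
    (U : Submodule ℝ W) (hU : ∀ x ∈ U, x ≠ 0 → ∃ y ∈ U, flat Ω x y ≠ 0) {u w : W} (hu : u ∈ U)
    (hw : w ∈ U) (huw : flat Ω u w ≠ 0) :
    ∃ U' ≤ U, Module.finrank ℝ U' + 2 = Module.finrank ℝ U ∧
      (∀ x ∈ U', flat Ω u x = 0 ∧ flat Ω w x = 0) ∧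
      ∀ x ∈ U', x ≠ 0 → ∃ y ∈ U', flat Ω x y ≠ 0 := by
  have hwu : flat Ω w u ≠ 0 := by rw [← flat_neg]; exact neg_ne_zero.2 huw
  let f : U →ₗ[ℝ] ℝ × ℝ := ((flat Ω u).prod (flat Ω w)).comp U.subtype
  have hf : Function.Surjective f := by
    rintro ⟨a, b⟩
    refine ⟨(a / flat Ω u w) • ⟨w, hw⟩ + (b / flat Ω w u) • ⟨u, hu⟩, ?_⟩
    simp [f, flat_self, huw, hwu]
  have hmem : ∀ x, x ∈ (LinearMap.ker f).map U.subtype ↔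
      x ∈ U ∧ flat Ω u x = 0 ∧ flat Ω w x = 0 := fun x => by
    simp [f, Prod.ext_iff, and_comm, and_left_comm]
  refine ⟨(LinearMap.ker f).map U.subtype, U.map_subtype_le _, ?_,
    fun x hx => ((hmem x).1 hx).2, fun x hx hx0 => ?_⟩
  · rw [Submodule.finrank_map_subtype_eq,
      ← LinearMap.finrank_range_add_finrank_ker f, LinearMap.range_eq_top.2 hf, finrank_top]
    simp [add_comm]
  · obtain ⟨hxU, hux, hwx⟩ := (hmem x).1 hx
    obtain ⟨y, hy, hxy⟩ := hU x hxU hx0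
    have hxu : flat Ω x u = 0 := by rw [← flat_neg, hux, neg_zero]
    have hxw : flat Ω x w = 0 := by rw [← flat_neg, hwx, neg_zero]
    refine ⟨y - (flat Ω u y / flat Ω u w) • w - (flat Ω w y / flat Ω w u) • u,
      (hmem _).2 ⟨U.sub_mem (U.sub_mem hy (U.smul_mem _ hw)) (U.smul_mem _ hu), ?_, ?_⟩, ?_⟩
    · simp [flat_self, huw]
    · simp [flat_self, hwu]
    · simpa [hxu, hxw] using hxy

theorem exists_darboux_family [FiniteDimensional ℝ W] (Ω : W [⋀^Fin 2]→ₗ[ℝ] ℝ) (k : ℕ)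
    (U : Submodule ℝ W) (hU : ∀ x ∈ U, x ≠ 0 → ∃ y ∈ U, flat Ω x y ≠ 0)
    (hk : Module.finrank ℝ U = 2 * k) :
    ∃ v : Fin k × Fin 2 → W, (∀ x, v x ∈ U) ∧ ∀ x y, flat Ω (v x) (v y) = darboux x y := by
  induction k generalizing U with
  | zero => exact ⟨0, fun x => x.1.elim0, fun x => x.1.elim0⟩
  | succ k ih =>
    obtain ⟨u, hu, hu0⟩ := U.exists_mem_ne_zero_of_ne_bot (by rintro rfl; simp at hk)
    obtain ⟨w, hw, huw⟩ := hU u hu hu0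
    obtain ⟨U', hU', hfin, horth, hnd⟩ := exists_orthogonal_pair Ω U hU hu hw huw
    obtain ⟨v, hv, hvΩ⟩ := ih U' hnd (by omega)
    let p : Fin 2 → W := ![u, (flat Ω u w)⁻¹ • w]
    have hp : ∀ a, p a ∈ U := by
      intro a
      fin_cases a
      · exact hu
      · exact U.smul_mem _ hw
    have hpv : ∀ a x, flat Ω (p a) (v x) = 0 := by
      intro a x
      fin_cases a <;> simp [p, horth _ (hv x)]
    have hvp : ∀ a x, flat Ω (v x) (p a) = 0 := fun a x => by rw [← flat_neg, hpv, neg_zero]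
    have hpp : ∀ a b, flat Ω (p a) (p b) = ((b : ℕ) : ℝ) - ((a : ℕ) : ℝ) := by
      intro a b
      fin_cases a <;> fin_cases b <;> simp [p, flat_self, huw, ← flat_neg Ω u w]
    refine ⟨fun x => Fin.cases (p x.2) (fun i => v (i, x.2)) x.1, ?_, ?_⟩
    · rintro ⟨i, a⟩
      refine Fin.cases (hp a) (fun i => hU' (hv (i, a))) i
    · rintro ⟨i, a⟩ ⟨j, b⟩
      refine Fin.cases ?_ (fun i => ?_) i <;> refine Fin.cases ?_ (fun j => ?_) j
      · simp [darboux, hpp]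
      · simp [darboux, hpv, (Fin.succ_ne_zero _).symm]
      · simp [darboux, hvp]
      · simp [darboux, hvΩ]

end Symplectic

/-- Let `(W, Ω)` be a `2n`-dimensional real symplectic vector space,
`V ⊂ W` a hyperplane, and `w ∈ W` with `w ∉ V`. Then `θ := (ι_w Ω)|_V` and `η := Ω|_V`
form a linear cosymplectic pair on `V`. -/
theorem hyperplane_pair_isCosymplectic
    {W : Type*} [AddCommGroup W] [Module ℝ W] [FiniteDimensional ℝ W]
    {n : ℕ} (hn : 1 ≤ n) (hdimW : Module.finrank ℝ W = 2 * n)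
    (Ω : W [⋀^Fin 2]→ₗ[ℝ] ℝ)
    (hΩ : ∀ u : W, u ≠ 0 → ∃ w : W, Ω ![u, w] ≠ 0)
    (V : Submodule ℝ W) (hV : Module.finrank ℝ V = 2 * n - 1)
    (w : W) (hw : w ∉ V) :
    IsCosymplecticPair n ((flat Ω w).comp V.subtype) (Ω.compLinearMap V.subtype) := by
  obtain ⟨g, hgw, hgV⟩ := V.exists_le_ker_of_notMem hw
  have hker : V = LinearMap.ker g := by
    refine Submodule.eq_of_le_of_finrank_le hgV ?_
    have hlt : Module.finrank ℝ (LinearMap.ker g) < Module.finrank ℝ W :=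
      Submodule.finrank_lt fun h => hgw (by
        have : w ∈ LinearMap.ker g := h ▸ Submodule.mem_top
        exact this)
    omega
  have hinj : Function.Injective (flat Ω) := by
    rw [← LinearMap.ker_eq_bot, LinearMap.ker_eq_bot']
    intro u hu
    by_contra hu0
    obtain ⟨y, hy⟩ := hΩ u hu0
    exact hy (by rw [← flat_apply, hu, LinearMap.zero_apply])
  obtain ⟨r, rfl⟩ := (LinearMap.injective_iff_surjective_of_finrank_eq_finrank
    (Subspace.dual_finrank_eq (K := ℝ) (V := W)).symm).1 hinj g
  have hrV : r ∈ V := by rw [hker]; exact flat_self Ω r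
  obtain ⟨U, -, hfin, horth, hnd⟩ := exists_orthogonal_pair Ω ⊤
    (fun x _ hx => by simpa [flat_apply] using hΩ x hx) (u := r) (w := w) trivial trivial hgw
  rw [finrank_top] at hfin
  obtain ⟨v, hv, hvΩ⟩ := exists_darboux_family Ω (n - 1) U hnd (by omega)
  have hvV : ∀ x, v x ∈ V := fun x => by rw [hker]; exact (horth _ (hv x)).1
  refine wedge_oneForm_wpow_ne_zero ⟨r, hrV⟩ (fun x => ⟨v x, hvV x⟩) ?_ ?_ ?_
  · change flat Ω w r ≠ 0
    rw [← flat_neg]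
    exact neg_ne_zero.2 hgw
  · exact fun x => (horth _ (hv x)).2
  · intro x y
    rw [← hvΩ, flat_apply, AlternatingMap.compLinearMap_apply]
    congr 1
    ext i
    fin_cases i <;> rfl
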